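/- Let I be a countable set and c : (I →₀ ℕ) → ℝ≥0; let f(z) = ∑_μ c_μ · z^μ ∈ [0,∞] for z : I → ℝ≥0. Let x, u : I → ℝ≥0 be such that f(x+u) < ∞. Then the function ε ↦ (f(x + ε·u) − f(x))/ε is nondecreasing on (0,1], and as ε → 0⁺ it tends (in [0,∞]) to ∑_{a∈I} u(a) · ( ∑_μ (μ(a)+1) · c_{μ+δ_a} · x^μ ), where μ + δ_a is the multi-index μ with its value at a increased by 1. -/

import Mathlib

open scoped NNReal ENNReal

/-- The power series with nonnegative coefficients `c` indexed by finitely supported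
multi-indices, evaluated at `z : I → ℝ≥0`, in `[0,∞]`. -/
noncomputable def powerSeries {I : Type*} (c : (I →₀ ℕ) → ℝ≥0) (z : I → ℝ≥0) : ℝ≥0∞ :=
  ∑' μ : I →₀ ℕ, (c μ : ℝ≥0∞) * μ.prod (fun a n => (z a : ℝ≥0∞) ^ n)

open Polynomial in
/-- The monomial `z ^ μ` restricted to the line `ε ↦ x + ε u`, as a polynomial in `ε`. -/
noncomputable def linePoly {I : Type*} (x u : I → ℝ≥0) (μ : I →₀ ℕ) : ℝ≥0[X] :=
  μ.prod fun a n => (C (x a) + C (u a) * X) ^ n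

theorem eval_linePoly {I : Type*} (x u : I → ℝ≥0) (μ : I →₀ ℕ) (ε : ℝ≥0) :
    (linePoly x u μ).eval ε = μ.prod fun a n => (x a + ε * u a) ^ n := by
  simp [linePoly, Finsupp.prod, Polynomial.eval_prod, mul_comm ε]

theorem coeff_zero_linePoly {I : Type*} (x u : I → ℝ≥0) (μ : I →₀ ℕ) :
    (linePoly x u μ).coeff 0 = μ.prod fun a n => x a ^ n := by
  simp [Polynomial.coeff_zero_eq_eval_zero, eval_linePoly]

theorem prod_tsub_single {I R : Type*} [CommMonoid R] [DecidableEq I] (x : I → R) (μ : I →₀ ℕ)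
    {a : I} (ha : a ∈ μ.support) :
    ((μ - Finsupp.single a 1).prod fun b n => x b ^ n) =
      (∏ b ∈ μ.support.erase a, x b ^ μ b) * x a ^ (μ a - 1) := by
  rw [Finsupp.prod_of_support_subset _ Finsupp.support_tsub _ (by simp),
    ← Finset.prod_erase_mul _ _ ha]
  congr 1
  · refine Finset.prod_congr rfl fun b hb => ?_
    simp [Finsupp.single_eq_of_ne (Finset.ne_of_mem_erase hb)]
  · simp

theorem coeff_one_linePoly {I : Type*} (x u : I → ℝ≥0) (μ : I →₀ ℕ) :
    (linePoly x u μ).coeff 1 = ∑ a ∈ μ.support,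
      u a * (μ a * (μ - Finsupp.single a 1).prod fun b n => x b ^ n) := by
  classical
  have h : (linePoly x u μ).coeff 1 = (Polynomial.derivative (linePoly x u μ)).eval 0 := by
    simp [← Polynomial.coeff_zero_eq_eval_zero, Polynomial.coeff_derivative]
  rw [h, linePoly, Finsupp.prod, Polynomial.derivative_prod_finset, Polynomial.eval_finsetSum]
  refine Finset.sum_congr rfl fun a ha => ?_
  rw [prod_tsub_single x μ ha]
  simp [Polynomial.derivative_pow, Polynomial.eval_prod]
  ring

theorem monotone_eval_nnreal (p : Polynomial ℝ≥0) : Monotone fun ε => p.eval ε := by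
  intro s t hst
  simp only [Polynomial.eval_eq_sum, Polynomial.sum]
  gcongr

theorem coe_finsuppProd_pow {I : Type*} (z : I → ℝ≥0) (μ : I →₀ ℕ) :
    ((μ.prod fun a n => z a ^ n : ℝ≥0) : ℝ≥0∞) = μ.prod fun a n => (z a : ℝ≥0∞) ^ n := by
  simp [Finsupp.prod]

theorem powerSeries_line {I : Type*} (c : (I →₀ ℕ) → ℝ≥0) (x u : I → ℝ≥0) (ε : ℝ≥0) :
    powerSeries c (fun a => x a + ε * u a) =
      ε * (∑' μ, (c μ : ℝ≥0∞) * ((linePoly x u μ).divX.eval ε : ℝ≥0)) + powerSeries c x := by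
  rw [powerSeries, powerSeries, ← ENNReal.tsum_mul_left, ← ENNReal.tsum_add]
  refine tsum_congr fun μ => ?_
  have h := congrArg (Polynomial.eval ε) (Polynomial.divX_mul_X_add (linePoly x u μ))
  rw [eval_linePoly, Polynomial.eval_add, Polynomial.eval_mul, Polynomial.eval_X,
    Polynomial.eval_C, coeff_zero_linePoly] at h
  rw [← coe_finsuppProd_pow, ← coe_finsuppProd_pow, ← h]
  push_cast
  ring

theorem tsum_coeff_one_linePoly {I : Type*} (c : (I →₀ ℕ) → ℝ≥0) (x u : I → ℝ≥0) :
    (∑' μ, (c μ : ℝ≥0∞) * ((linePoly x u μ).coeff 1 : ℝ≥0)) =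
      ∑' a : I, (u a : ℝ≥0∞) *
        ∑' μ : I →₀ ℕ, ((μ a : ℝ≥0∞) + 1) * (c (μ + Finsupp.single a 1) : ℝ≥0∞) *
          μ.prod (fun b n => (x b : ℝ≥0∞) ^ n) := by
  have h (μ : I →₀ ℕ) : (c μ : ℝ≥0∞) * ((linePoly x u μ).coeff 1 : ℝ≥0) =
      ∑' a : I, (u a : ℝ≥0∞) * ((μ a : ℝ≥0∞) * c μ *
        (μ - Finsupp.single a 1).prod fun b n => (x b : ℝ≥0∞) ^ n) := by
    rw [tsum_eq_sum (s := μ.support) (by simp +contextual), coeff_one_linePoly,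
      ENNReal.ofNNReal_finsetSum, Finset.mul_sum]
    refine Finset.sum_congr rfl fun a _ => ?_
    rw [← coe_finsuppProd_pow]
    push_cast
    ring
  rw [tsum_congr h, ENNReal.tsum_comm]
  refine tsum_congr fun a => ?_
  have hshift := (add_left_injective (Finsupp.single a 1)).tsum_eq (f := fun μ : I →₀ ℕ =>
    (μ a : ℝ≥0∞) * c μ * ((μ - Finsupp.single a 1).prod fun b n => (x b : ℝ≥0∞) ^ n : ℝ≥0∞)) ?_
  · rw [ENNReal.tsum_mul_left, ← hshift]
    simp
  · intro μ hμ
    have ha : μ a ≠ 0 := fun h0 => hμ (by simp [h0])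
    refine ⟨μ - Finsupp.single a 1, tsub_add_cancel_of_le ?_⟩
    rw [Finsupp.single_le_iff]
    omega

theorem tendsto_tsum_of_dominated {α β : Type*} {l : Filter α} [l.IsCountablyGenerated]
    {F : α → β → ℝ≥0∞} {f : β → ℝ≥0∞} (bound : β → ℝ≥0∞) (hbound : ∑' b, bound b ≠ ⊤)
    (h_le : ∀ᶠ n in l, ∀ b, F n b ≤ bound b)
    (h_lim : ∀ b, Filter.Tendsto (fun n => F n b) l (nhds (f b))) :
    Filter.Tendsto (fun n => ∑' b, F n b) l (nhds (∑' b, f b)) := by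
  let _ : MeasurableSpace β := ⊤
  simp only [← MeasureTheory.lintegral_count] at hbound ⊢
  exact MeasureTheory.tendsto_lintegral_filter_of_dominated_convergence bound
    (.of_forall fun _ => measurable_from_top) (h_le.mono fun _ h => .of_forall h) hbound
    (.of_forall h_lim)

/-- If `f(x+u) < ∞`, then the difference quotient `ε ↦ (f(x+εu) − f(x))/ε` is
nondecreasing on `(0,1]` and tends, as `ε → 0⁺`, to the directional derivative
`∑_a u a * (∑_μ (μ a + 1) * c_{μ + δ_a} * x^μ)` in `[0,∞]`. -/
theorem stmt7 {I : Type*} [Countable I] (c : (I →₀ ℕ) → ℝ≥0) (x u : I → ℝ≥0)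
    (hfin : powerSeries c (fun a => x a + u a) < ⊤) :
    (∀ ε₁ ε₂ : ℝ≥0, 0 < ε₁ → ε₁ ≤ ε₂ → ε₂ ≤ 1 →
      (powerSeries c (fun a => x a + ε₁ * u a) - powerSeries c x) / (ε₁ : ℝ≥0∞) ≤
      (powerSeries c (fun a => x a + ε₂ * u a) - powerSeries c x) / (ε₂ : ℝ≥0∞)) ∧
    Filter.Tendsto
      (fun ε : ℝ≥0 =>
        (powerSeries c (fun a => x a + ε * u a) - powerSeries c x) / (ε : ℝ≥0∞))
      (nhdsWithin 0 (Set.Ioc 0 1))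
      (nhds (∑' a : I, (u a : ℝ≥0∞) *
        ∑' μ : I →₀ ℕ, ((μ a : ℝ≥0∞) + 1) * (c (μ + Finsupp.single a 1) : ℝ≥0∞) *
          μ.prod (fun b n => (x b : ℝ≥0∞) ^ n))) := by
  have hone := powerSeries_line c x u 1
  simp only [one_mul, ENNReal.coe_one] at hone
  rw [hone, ENNReal.add_lt_top] at hfin
  have hquot (ε : ℝ≥0) (hε : 0 < ε) :
      (powerSeries c (fun a => x a + ε * u a) - powerSeries c x) / (ε : ℝ≥0∞) =
        ∑' μ, (c μ : ℝ≥0∞) * ((linePoly x u μ).divX.eval ε : ℝ≥0) := by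
    rw [powerSeries_line, ENNReal.add_sub_cancel_right hfin.2.ne, mul_comm,
      ENNReal.mul_div_cancel_right (by exact_mod_cast hε.ne') ENNReal.coe_ne_top]
  have hmono {s t : ℝ≥0} (hst : s ≤ t) (μ : I →₀ ℕ) :
      (c μ : ℝ≥0∞) * ((linePoly x u μ).divX.eval s : ℝ≥0) ≤
        c μ * ((linePoly x u μ).divX.eval t : ℝ≥0) := by
    gcongr
    exact monotone_eval_nnreal _ hst
  refine ⟨fun ε₁ ε₂ h₀ h₁₂ _ => ?_, ?_⟩
  · rw [hquot ε₁ h₀, hquot ε₂ (h₀.trans_le h₁₂)]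
    exact ENNReal.tsum_le_tsum (hmono h₁₂)
  · rw [← tsum_coeff_one_linePoly]
    have hmem : ∀ᶠ ε : ℝ≥0 in nhdsWithin 0 (Set.Ioc 0 1), ε ∈ Set.Ioc (0 : ℝ≥0) 1 :=
      self_mem_nhdsWithin
    refine Filter.Tendsto.congr' (hmem.mono fun ε hε => (hquot ε hε.1).symm) ?_
    refine tendsto_tsum_of_dominated _ hfin.1.ne (hmem.mono fun ε hε => hmono hε.2) fun μ => ?_
    refine ENNReal.Tendsto.const_mul ?_ (Or.inr ENNReal.coe_ne_top)
    have hcont : Filter.Tendsto (fun ε => (linePoly x u μ).divX.eval ε) (nhds 0)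
        (nhds ((linePoly x u μ).coeff 1)) := by
      have h := (linePoly x u μ).divX.continuous.tendsto 0
      rwa [← Polynomial.coeff_zero_eq_eval_zero, Polynomial.coeff_divX] at h
    exact ENNReal.tendsto_coe.2 (hcont.mono_left nhdsWithin_le_nhds)
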